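/- arXiv:1005.0702 — 2 statements merged into one kernel-verified Lean document; each statement's English description precedes it below -/
import Mathlib

section
/- Let f : I ⊆ [0, ∞) → ℝ be differentiable on I°, a, b ∈ I with a < b, and f' integrable on [a, b]. If |f'| is convex on [a, b], then |f((a+b)/2) − (1/(b−a)) ∫_a^b f(u) du| ≤ ((b−a)/4) · (|f'(a)| + |f'(b)|)/2. -/
open Set MeasureTheory intervalIntegral

/-- A function whose derivative is bounded in absolute value by that of `G` on `(a, b)` has
increments bounded by those of `G`. -/
theorem abs_sub_le_sub_of_abs_deriv_le {f G L : ℝ → ℝ} {a b : ℝ}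
    (hf : ∀ t ∈ Ioo a b, DifferentiableAt ℝ f t)
    (hG : ∀ t, HasDerivAt G (L t) t) (hL : ∀ t ∈ Ioo a b, |deriv f t| ≤ L t)
    {x y : ℝ} (hx : x ∈ Ioo a b) (hy : y ∈ Ioo a b) (hxy : x ≤ y) :
    |f y - f x| ≤ G y - G x := by
  have h₁ : MonotoneOn (fun t => G t - f t) (Ioo a b) := by
    refine monotoneOn_of_hasDerivWithinAt_nonneg (convex_Ioo a b) (f' := fun t => L t - deriv f t)
      (fun t ht => ((hG t).sub (hf t ht).hasDerivAt).continuousAt.continuousWithinAt) ?_ ?_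
    · rw [interior_Ioo]
      exact fun t ht => ((hG t).sub (hf t ht).hasDerivAt).hasDerivWithinAt
    · rw [interior_Ioo]
      exact fun t ht => sub_nonneg.2 ((le_abs_self _).trans (hL t ht))
  have h₂ : MonotoneOn (fun t => G t + f t) (Ioo a b) := by
    refine monotoneOn_of_hasDerivWithinAt_nonneg (convex_Ioo a b) (f' := fun t => L t + deriv f t)
      (fun t ht => ((hG t).add (hf t ht).hasDerivAt).continuousAt.continuousWithinAt) ?_ ?_
    · rw [interior_Ioo]
      exact fun t ht => ((hG t).add (hf t ht).hasDerivAt).hasDerivWithinAt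
    · rw [interior_Ioo]
      intro t ht
      linarith [neg_abs_le (deriv f t), hL t ht]
  have h₃ := h₁ hx hy hxy
  have h₄ := h₂ hx hy hxy
  simp only at h₃ h₄
  rw [abs_le]
  constructor <;> linarith

/-- A convex function on `[a, b]` lies below its chord, written around the midpoint. -/
theorem ConvexOn.le_chord_midpoint {g : ℝ → ℝ} {a b : ℝ} (hg : ConvexOn ℝ (Icc a b) g)
    (hab : a < b) {t : ℝ} (ht : t ∈ Icc a b) :
    g t ≤ (g a + g b) / 2 + (g b - g a) / (b - a) * (t - (a + b) / 2) := by
  have hba : 0 < b - a := sub_pos.2 hab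
  have h := hg.2 (left_mem_Icc.2 hab.le) (right_mem_Icc.2 hab.le)
    (div_nonneg (sub_nonneg.2 ht.2) hba.le) (div_nonneg (sub_nonneg.2 ht.1) hba.le)
    (by field_simp; ring)
  simp only [smul_eq_mul] at h
  have e : (b - t) / (b - a) * a + (t - a) / (b - a) * b = t := by field_simp; ring
  rw [e] at h
  refine h.trans_eq ?_
  field_simp
  ring

theorem integral_linear_add_quadratic (c d m x y : ℝ) :
    ∫ u in x..y, (c * (u - m) + d / 2 * (u - m) ^ 2) =
      (c / 2 * (y - m) ^ 2 + d / 6 * (y - m) ^ 3) -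
        (c / 2 * (x - m) ^ 2 + d / 6 * (x - m) ^ 3) := by
  refine integral_eq_sub_of_hasDerivAt
    (f := fun u => c / 2 * (u - m) ^ 2 + d / 6 * (u - m) ^ 3) (fun u _ => ?_)
    (Continuous.intervalIntegrable (by fun_prop) _ _)
  have h := (hasDerivAt_id' u).sub_const m
  refine (((h.pow 2).const_mul (c / 2)).add ((h.pow 3).const_mul (d / 6))).congr_deriv ?_
  norm_num
  ring

/-- Midpoint inequality when `|f'|` is convex on `[a, b]`. -/
theorem midpoint_convex_abs_deriv
    (f : ℝ → ℝ) (I : Set ℝ) (hI : Convex ℝ I) (hI0 : I ⊆ Ici (0:ℝ))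
    (a b : ℝ) (ha : a ∈ I) (hb : b ∈ I) (hab : a < b)
    (hdiff : DifferentiableOn ℝ f (interior I))
    (hint : IntervalIntegrable (deriv f) volume a b)
    (hconv : ConvexOn ℝ (Icc a b) (fun t => |deriv f t|)) :
    |f ((a + b) / 2) - (1 / (b - a)) * ∫ u in a..b, f u|
      ≤ (b - a) / 4 * ((|deriv f a| + |deriv f b|) / 2) := by
  have hba : 0 < b - a := sub_pos.2 hab
  have hsub : Ioo a b ⊆ interior I :=
    interior_maximal (Ioo_subset_Icc_self.trans (hI.ordConnected.out ha hb)) isOpen_Ioo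
  have hf : ∀ t ∈ Ioo a b, DifferentiableAt ℝ f t := fun t ht =>
    hdiff.differentiableAt (isOpen_interior.mem_nhds (hsub ht))
  set m := (a + b) / 2 with hm
  set c := (|deriv f a| + |deriv f b|) / 2
  set d := (|deriv f b| - |deriv f a|) / (b - a)
  have ham : a < m := by rw [hm]; linarith
  have hmb : m < b := by rw [hm]; linarith
  set G : ℝ → ℝ := fun u => c * (u - m) + d / 2 * (u - m) ^ 2 with hGdef
  have hGc : Continuous G := by fun_prop
  have hG : ∀ t, HasDerivAt G (c + d * (t - m)) t := by
    intro t
    have h := (hasDerivAt_id' t).sub_const m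
    refine ((h.const_mul c).add ((h.pow 2).const_mul (d / 2))).congr_deriv ?_
    norm_num
    ring
  have hL : ∀ t ∈ Ioo a b, |deriv f t| ≤ c + d * (t - m) := fun t ht =>
    hconv.le_chord_midpoint hab (Ioo_subset_Icc_self ht)
  have hGm : G m = 0 := by simp [hGdef]
  have hleft : ∀ u ∈ Ioo a b, u ≤ m → |f m - f u| ≤ - G u := fun u hu hum => by
    simpa [hGm] using abs_sub_le_sub_of_abs_deriv_le hf hG hL hu ⟨ham, hmb⟩ hum
  have hright : ∀ u ∈ Ioo a b, m ≤ u → |f m - f u| ≤ G u := fun u hu hum => by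
    simpa [hGm, abs_sub_comm] using abs_sub_le_sub_of_abs_deriv_le hf hG hL ⟨ham, hmb⟩ hu hum
  have hne : ∀ᵐ u : ℝ, u ≠ b := Measure.ae_ne volume b
  have hdiffint : IntervalIntegrable (fun u => f m - f u) volume a b := by
    refine (hGc.abs.intervalIntegrable a b).mono_fun' ?_ ?_
    · rw [uIoc_of_le hab.le, ← restrict_Ioo_eq_restrict_Ioc]
      exact ContinuousOn.aestronglyMeasurable (continuousOn_const.sub
        fun t ht => (hf t ht).continuousAt.continuousWithinAt) measurableSet_Ioo
    · rw [uIoc_of_le hab.le, ← restrict_Ioo_eq_restrict_Ioc]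
      refine (ae_restrict_mem measurableSet_Ioo).mono fun u hu => ?_
      rcases le_total u m with h | h
      · exact (hleft u hu h).trans (neg_le_abs _)
      · exact (hright u hu h).trans (le_abs_self _)
  have hfint : IntervalIntegrable f volume a b := by
    simpa using (intervalIntegrable_const (c := f m)).sub hdiffint
  have hA : |∫ u in a..m, (f m - f u)| ≤ ∫ u in a..m, - G u := by
    rw [← Real.norm_eq_abs]
    refine norm_integral_le_of_norm_le ham.le (.of_forall fun u hu => ?_)
      (hGc.neg.intervalIntegrable _ _)
    exact hleft u ⟨hu.1, hu.2.trans_lt hmb⟩ hu.2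
  have hB : |∫ u in m..b, (f m - f u)| ≤ ∫ u in m..b, G u := by
    rw [← Real.norm_eq_abs]
    refine norm_integral_le_of_norm_le hmb.le (hne.mono fun u hub hu => ?_)
      (hGc.intervalIntegrable _ _)
    exact hright u ⟨ham.trans hu.1, hu.2.lt_of_ne hub⟩ hu.1.le
  have hsplit : (∫ u in a..m, (f m - f u)) + ∫ u in m..b, (f m - f u) =
      ∫ u in a..b, (f m - f u) := by
    have hmem : m ∈ uIcc a b := by rw [uIcc_of_le hab.le]; exact ⟨ham.le, hmb.le⟩
    exact integral_add_adjacent_intervals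
      (hdiffint.mono_set (uIcc_subset_uIcc left_mem_uIcc hmem))
      (hdiffint.mono_set (uIcc_subset_uIcc hmem right_mem_uIcc))
  have hmain : |∫ u in a..b, (f m - f u)| ≤ (b - a) ^ 2 / 4 * c := by
    rw [← hsplit]
    refine (abs_add_le _ _).trans ((add_le_add hA hB).trans_eq ?_)
    rw [intervalIntegral.integral_neg, hGdef, integral_linear_add_quadratic,
      integral_linear_add_quadratic, hm]
    ring
  have hrw : f m - 1 / (b - a) * ∫ u in a..b, f u =
      1 / (b - a) * ∫ u in a..b, (f m - f u) := by
    rw [integral_sub intervalIntegrable_const hfint, intervalIntegral.integral_const, smul_eq_mul]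
    field_simp
  rw [hrw, abs_mul, abs_of_pos (one_div_pos.2 hba)]
  refine (mul_le_mul_of_nonneg_left hmain (one_div_pos.2 hba).le).trans_eq ?_
  field_simp
end

section
/- Let f : I ⊆ [0, ∞) → ℝ be differentiable on I°, a, b ∈ I with a < b, and f' integrable on [a, b]. Let p > 1 and q with 1/p + 1/q = 1, and suppose |f'|^q is convex on [a, b]. If moreover f'(a) = f'((a+b)/2) = f'(b), then |f((a+b)/2) − (1/(b−a)) ∫_a^b f(u) du| ≤ ((b−a)/(p+1)^{1/p}) · (|f'(b)| + |f'(a)|)/4. -/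
open Set MeasureTheory intervalIntegral

lemma integral_abs_sub_midpoint {a b : ℝ} (hab : a ≤ b) :
    ∫ u in a..b, |u - (a + b) / 2| = (b - a) ^ 2 / 4 := by
  have hc : Continuous fun u : ℝ => |u - (a + b) / 2| := by fun_prop
  rw [← integral_add_adjacent_intervals (hc.intervalIntegrable a ((a + b) / 2))
    (hc.intervalIntegrable ((a + b) / 2) b)]
  have h1 : ∫ u in a..((a + b) / 2), |u - (a + b) / 2|
      = ∫ u in a..((a + b) / 2), ((a + b) / 2 - u) := by
    refine integral_congr fun u hu => ?_
    rw [uIcc_of_le (by linarith)] at hu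
    simp only [abs_of_nonpos (sub_nonpos.2 hu.2), neg_sub]
  have h2 : ∫ u in ((a + b) / 2)..b, |u - (a + b) / 2|
      = ∫ u in ((a + b) / 2)..b, (u - (a + b) / 2) := by
    refine integral_congr fun u hu => ?_
    rw [uIcc_of_le (by linarith)] at hu
    simp only [abs_of_nonneg (sub_nonneg.2 hu.1)]
  rw [h1, h2, intervalIntegral.integral_sub (by simp) (by simp),
    intervalIntegral.integral_sub (by simp) (by simp)]
  simp only [integral_id, intervalIntegral.integral_const, smul_eq_mul]
  ring

/-- Ostrowski's inequality at the midpoint for a globally Lipschitz function. -/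
lemma LipschitzWith.abs_midpoint_sub_average_le {g : ℝ → ℝ} {K : NNReal}
    (hg : LipschitzWith K g) {a b : ℝ} (hab : a < b) :
    |g ((a + b) / 2) - (1 / (b - a)) * ∫ u in a..b, g u| ≤ K * ((b - a) / 4) := by
  have hba : 0 < b - a := sub_pos.2 hab
  have hgi : IntervalIntegrable g volume a b := hg.continuous.intervalIntegrable a b
  have hrw : g ((a + b) / 2) - (1 / (b - a)) * ∫ u in a..b, g u
      = (1 / (b - a)) * ∫ u in a..b, (g ((a + b) / 2) - g u) := by
    rw [intervalIntegral.integral_sub (by simp) hgi, intervalIntegral.integral_const, smul_eq_mul]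
    field_simp
  have hle : |∫ u in a..b, (g ((a + b) / 2) - g u)| ≤ K * ((b - a) ^ 2 / 4) := by
    rw [← integral_abs_sub_midpoint hab.le, ← intervalIntegral.integral_const_mul,
      ← Real.norm_eq_abs]
    refine norm_integral_le_of_norm_le hab.le (.of_forall fun u _ => ?_)
      (Continuous.intervalIntegrable (by fun_prop) a b)
    rw [abs_sub_comm]
    simpa [Real.dist_eq] using hg.dist_le_mul ((a + b) / 2) u
  rw [hrw, abs_mul, abs_of_pos (one_div_pos.2 hba)]
  calc 1 / (b - a) * |∫ u in a..b, (g ((a + b) / 2) - g u)|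
      ≤ 1 / (b - a) * (K * ((b - a) ^ 2 / 4)) := by gcongr
    _ = K * ((b - a) / 4) := by field_simp

/-- Ostrowski's inequality at the midpoint; nothing is assumed about `f` at the endpoints. -/
lemma LipschitzOnWith.abs_midpoint_sub_average_le {f : ℝ → ℝ} {K : NNReal} {a b : ℝ}
    (hf : LipschitzOnWith K f (Ioo a b)) (hab : a < b) :
    |f ((a + b) / 2) - (1 / (b - a)) * ∫ u in a..b, f u| ≤ K * ((b - a) / 4) := by
  obtain ⟨g, hg, hfg⟩ := hf.extend_real
  have hI : ∫ u in a..b, f u = ∫ u in a..b, g u := by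
    rw [integral_of_le hab.le, integral_of_le hab.le, integral_Ioc_eq_integral_Ioo,
      integral_Ioc_eq_integral_Ioo]
    exact setIntegral_congr_fun measurableSet_Ioo hfg
  rw [hI, hfg ⟨by linarith, by linarith⟩]
  exact hg.abs_midpoint_sub_average_le hab

lemma Real.add_one_rpow_one_div_le_two {p : ℝ} (hp : 1 ≤ p) : (p + 1) ^ (1 / p) ≤ 2 := by
  have hp0 : 0 < p := by linarith
  rw [one_div, Real.rpow_inv_le_iff_of_pos (by linarith) (by norm_num) hp0]
  have h := one_add_mul_self_le_rpow_one_add (s := 1) (by norm_num) hp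
  norm_num at h
  linarith

/-- Corollary 2.6: midpoint inequality when `|f'|^q` is convex on `[a, b]` and
`f'(a) = f'((a+b)/2) = f'(b)`. -/
theorem midpoint_convex_pow_deriv_equal_derivs
    (f : ℝ → ℝ) (I : Set ℝ) (hI : Convex ℝ I) (hI0 : I ⊆ Ici (0:ℝ))
    (a b : ℝ) (ha : a ∈ I) (hb : b ∈ I) (hab : a < b)
    (hdiff : DifferentiableOn ℝ f (interior I))
    (hint : IntervalIntegrable (deriv f) volume a b)
    (p q : ℝ) (hp : 1 < p) (hpq : 1 / p + 1 / q = 1)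
    (hconv : ConvexOn ℝ (Icc a b) (fun t => |deriv f t| ^ q))
    (heq1 : deriv f a = deriv f ((a + b) / 2)) (heq2 : deriv f ((a + b) / 2) = deriv f b) :
    |f ((a + b) / 2) - (1 / (b - a)) * ∫ u in a..b, f u|
      ≤ (b - a) / (p + 1) ^ (1 / p) * ((|deriv f b| + |deriv f a|) / 4) := by
  have hq : 0 < q := by
    have h : 1 / p < 1 := (div_lt_one (by linarith)).2 hp
    exact one_div_pos.1 (by linarith)
  have hsub : Ioo a b ⊆ interior I :=
    interior_Icc.symm.subset.trans (interior_mono (hI.ordConnected.out ha hb))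
  have hbound : ∀ x ∈ Ioo a b, |deriv f x| ≤ |deriv f b| := by
    intro x hx
    have h := hconv.le_max_of_mem_Icc (left_mem_Icc.2 hab.le) (right_mem_Icc.2 hab.le)
      (Ioo_subset_Icc_self hx)
    rw [heq1, heq2, max_self] at h
    exact (Real.rpow_le_rpow_iff (abs_nonneg _) (abs_nonneg _) hq).1 h
  have hlip : LipschitzOnWith ‖deriv f b‖₊ f (Ioo a b) :=
    (convex_Ioo a b).lipschitzOnWith_of_nnnorm_deriv_le
      (fun x hx => hdiff.differentiableAt (isOpen_interior.mem_nhds (hsub hx)))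
      (fun x hx => hbound x hx)
  have hpos : 0 < (p + 1) ^ (1 / p) := Real.rpow_pos_of_pos (by linarith) _
  have hba : 0 < b - a := sub_pos.2 hab
  calc |f ((a + b) / 2) - (1 / (b - a)) * ∫ u in a..b, f u|
      ≤ |deriv f b| * ((b - a) / 4) := hlip.abs_midpoint_sub_average_le hab
    _ = (b - a) / 2 * ((|deriv f b| + |deriv f a|) / 4) := by rw [heq1, heq2]; ring
    _ ≤ (b - a) / (p + 1) ^ (1 / p) * ((|deriv f b| + |deriv f a|) / 4) := by
      gcongr
      exact Real.add_one_rpow_one_div_le_two hp.le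
end
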